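/- Let g be a finite dimensional simple Lie algebra over an algebraically closed field k of characteristic 0, graded by Q_h × Λ̄ via a Cartan subalgebra h of g^σ and commuting finite-order automorphisms σ. If g_α^λ̄ ≠ 0 for a nonzero root α and λ̄ ∈ Λ̄, then dim g_α^λ̄ = 1. -/

import Mathlib

/-- The common fixed-point subalgebra of a family of Lie algebra automorphisms. -/
def fixedLieSubalgebra {k L : Type*} [CommRing k] [LieRing L] [LieAlgebra k L]
    {n : ℕ} (σ : Fin n → (L ≃ₗ[k] L))
    (hlie : ∀ i (x y : L), σ i ⁅x, y⁆ = ⁅σ i x, σ i y⁆) : LieSubalgebra k L where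
  carrier := {x | ∀ i, σ i x = x}
  add_mem' := fun {a b} ha hb i => by rw [map_add, ha i, hb i]
  zero_mem' := fun i => map_zero _
  smul_mem' := fun c {x} hx i => by rw [map_smul, hx i]
  lie_mem' := fun {x y} hx hy i => by rw [hlie i, hx i, hy i]

/-- The root space of `L` relative to a subalgebra `h`, attached to a functional `α` on `h`. -/
def rootSpaceOf {k L : Type*} [Field k] [LieRing L] [LieAlgebra k L]
    (h : LieSubalgebra k L) (α : Module.Dual k h) : Submodule k L where
  carrier := {x | ∀ H : h, ⁅(H : L), x⁆ = α H • x}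
  add_mem' := fun {a b} ha hb H => by rw [lie_add, ha H, hb H, smul_add]
  zero_mem' := fun H => by rw [lie_zero, smul_zero]
  smul_mem' := fun c {x} hx H => by rw [lie_smul, hx H, smul_comm]

open Module LieAlgebra LieModule

/-- A nonzero functional is nonzero on some joint eigenvector of commuting semisimple operators. -/
lemma exists_joint_eigenvector {k V ι : Type*} [Field k] [IsAlgClosed k] [AddCommGroup V]
    [Module k V] [FiniteDimensional k V] (f : ι → Module.End k V)
    (hc : ∀ i j, Commute (f i) (f j)) (hs : ∀ i, (f i).IsSemisimple)
    (φ : V →ₗ[k] k) (hφ : φ ≠ 0) :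
    ∃ (v : V) (χ : ι → k), (∀ i, f i v = χ i • v) ∧ φ v ≠ 0 := by
  by_contra! hcon
  apply hφ
  have htop := Module.End.iSup_iInf_maxGenEigenspace_eq_top_of_iSup_maxGenEigenspace_eq_top_of_commute
    f (fun i j _ => hc i j) (fun i => Module.End.iSup_maxGenEigenspace_eq_top _)
  have hle : (⊤ : Submodule k V) ≤ LinearMap.ker φ := by
    rw [← htop]
    refine iSup_le fun χ v hv => ?_
    rw [LinearMap.mem_ker]
    refine hcon v χ fun i => ?_
    have := (Submodule.mem_iInf _).1 hv i
    rw [(hs i).isFinitelySemisimple.maxGenEigenspace_eq_eigenspace] at this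
    exact Module.End.mem_eigenspace_iff.1 this
  ext v
  exact hle (Submodule.mem_top (x := v))

lemma killing_inv {k L : Type*} [Field k] [LieRing L] [LieAlgebra k L] (s : L ≃ₗ[k] L)
    (hlie : ∀ x y : L, s ⁅x, y⁆ = ⁅s x, s y⁆) (x y : L) :
    killingForm k L (s x) (s y) = killingForm k L x y :=
  killingForm_of_equiv_apply (R := k) (e := { s with map_lie' := fun {a b} => hlie a b }) x y

lemma finite_order_semisimple {k L : Type*} [Field k] [CharZero k] [AddCommGroup L] [Module k L]
    [FiniteDimensional k L] (s : L ≃ₗ[k] L) (m : ℕ) (hm : 0 < m) (h : s ^ m = 1) :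
    Module.End.IsSemisimple (s : L →ₗ[k] L) := by
  refine Module.End.isSemisimple_of_squarefree_aeval_eq_zero (p := Polynomial.X ^ m - 1)
    (Polynomial.X_pow_sub_one_separable_iff.2 (by exact_mod_cast hm.ne')).squarefree ?_
  have hp : ∀ (j : ℕ) (x : L), ((s : L →ₗ[k] L) ^ j) x = (s ^ j) x := by
    intro j
    induction j with
    | zero => intro x; simp
    | succ j ih => intro x; rw [pow_succ, pow_succ, Module.End.mul_apply, ih]; rfl
  ext x
  simp [hp, h]

section
variable {k L : Type*} [Field k] [IsAlgClosed k] [CharZero k]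
    [LieRing L] [LieAlgebra k L] [FiniteDimensional k L] [IsKilling k L]

/-- Elements of an abelian subalgebra with nondegenerate Killing form which equals
its centralizer in the fixed points are semisimple. -/
lemma semisimple_of_mem {ι : Type*} (σ : ι → (L ≃ₗ[k] L))
    (hlie : ∀ i (x y : L), σ i ⁅x, y⁆ = ⁅σ i x, σ i y⁆)
    (H : LieSubalgebra k L) (hab : ∀ a ∈ H, ∀ b ∈ H, ⁅a, b⁆ = 0)
    (hfix : ∀ a ∈ H, ∀ i, σ i a = a)
    (hcent : ∀ z, (∀ i, σ i z = z) → (∀ a ∈ H, ⁅a, z⁆ = 0) → z ∈ H)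
    (hnd : ∀ z ∈ H, (∀ a ∈ H, killingForm k L z a = 0) → z = 0)
    {x : L} (hx : x ∈ H) : (ad k L x).IsSemisimple := by
  have : IsLieAbelian H := ⟨fun a b => Subtype.ext (hab a a.2 b b.2)⟩
  obtain ⟨N, -, S, hS₁, hN, hS, hSN⟩ := (ad k L x).exists_isNilpotent_isSemisimple
  have hS₀ : Commute (ad k L x) S := Algebra.commute_of_mem_adjoin_self hS₁
  set x' : H := ⟨x, hx⟩
  rw [eq_sub_of_add_eq hSN.symm] at hN
  have aux {α : H → k} {y : L} (hy : y ∈ rootSpace H α) : S y = α x' • y := by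
    replace hy : y ∈ (ad k L x).maxGenEigenspace (α x') :=
      (genWeightSpace_le_genWeightSpaceOf L x' α) hy
    rw [Module.End.maxGenEigenspace_eq] at hy
    rw [Module.End.apply_eq_of_mem_of_comm_of_isFinitelySemisimple_of_isNil hy hS₀
      hS.isFinitelySemisimple hN]
  have h_der (y z : L) (α β : H → k) (hy : y ∈ rootSpace H α) (hz : z ∈ rootSpace H β) :
      S ⁅y, z⁆ = ⁅S y, z⁆ + ⁅y, S z⁆ := by
    have hyz : ⁅y, z⁆ ∈ rootSpace H (α + β) :=
      mapsTo_toEnd_genWeightSpace_add_of_mem_rootSpace k L H L α β hy hz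
    rw [aux hy, aux hz, aux hyz, smul_lie, lie_smul, ← add_smul, ← Pi.add_apply]
  replace h_der (y z : L) : S ⁅y, z⁆ = ⁅S y, z⁆ + ⁅y, S z⁆ := by
    have hy : y ∈ ⨆ α : H → k, rootSpace H α := by simp [iSup_genWeightSpace_eq_top]
    have hz : z ∈ ⨆ α : H → k, rootSpace H α := by simp [iSup_genWeightSpace_eq_top]
    induction hy using LieSubmodule.iSup_induction' with
    | mem α y hy =>
      induction hz using LieSubmodule.iSup_induction' with
      | mem β z hz => exact h_der y z α β hy hz
      | zero => simp
      | add _ _ _ _ h h' => simp only [lie_add, map_add, h, h']; abel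
    | zero => simp
    | add _ _ _ _ h h' => simp only [add_lie, map_add, h, h']; abel
  replace h_der : ∀ y z : L, S ⁅y, z⁆ = ⁅y, S z⁆ - ⁅z, S y⁆ := by
    simp_rw [← lie_skew (S _) _, add_comm, ← sub_eq_add_neg] at h_der; assumption
  let S' : LieDerivation k L L := ⟨S, h_der⟩
  obtain ⟨y, hy⟩ := LieDerivation.IsKilling.exists_eq_ad S'
  have hSy (z : L) : S z = ⁅y, z⁆ := by
    rw [← ad_apply (R := k), ← LieDerivation.coe_ad_apply_eq_ad_apply, hy]
  have hy1 (z : L) (hz : z ∈ H) : ⁅z, y⁆ = 0 := by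
    have hz' : z ∈ rootSpace H (0 : H → k) := le_zeroRootSubalgebra k L H hz
    rw [← lie_skew, ← hSy, aux hz']; simp
  have hinj : ∀ a b : L, (∀ z : L, ⁅a, z⁆ = ⁅b, z⁆) → a = b := by
    intro a b hab1
    rw [← sub_eq_zero, ← LieDerivation.IsKilling.ad_apply_eq_zero_iff (R := k)]
    ext z
    simp [hab1 z]
  have hy2 (i : ι) : σ i y = y := by
    have hcs : Commute (σ i : L →ₗ[k] L) (ad k L x) := by
      ext z
      simp [hlie, hfix x hx i]
    have hcs' : Commute (σ i : L →ₗ[k] L) S :=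
      Algebra.commute_of_mem_adjoin_singleton_of_commute hS₁ hcs
    refine hinj _ _ fun z => ?_
    obtain ⟨w, rfl⟩ := (σ i).surjective z
    rw [← hlie, ← hSy, ← hSy]
    exact LinearMap.congr_fun hcs' w
  have hyH : y ∈ H := hcent y hy2 hy1
  have hSad : S = ad k L y := by ext z; simp [hSy]
  suffices x = y by rwa [this, ← hSad]
  rw [← sub_eq_zero]
  refine hnd _ (H.sub_mem hx hyH) fun a ha => ?_
  have hnil : _root_.IsNilpotent (ad k L (x - y)) := by rwa [map_sub, ← hSad]
  have comm : Commute (ad k L (x - y)) (ad k L a) := by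
    change _ * _ = _ * _
    rw [← sub_eq_zero]
    ext z
    have h1 : ⁅x - y, a⁆ = 0 := hab _ (H.sub_mem hx hyH) _ ha
    have h2 := lie_lie (x - y) a z
    rw [h1, zero_lie] at h2
    exact h2.symm
  rw [killingForm_apply_apply, ← Module.End.mul_eq_comp]
  exact (LinearMap.isNilpotent_trace_of_isNilpotent (comm.isNilpotent_mul_right hnil)).eq_zero

/-- If `t = [x, y]` commutes with `x` and `y` and is semisimple, then it acts trivially. -/
lemma ad_eq_zero_of_comm {x y t : L} (ht : ⁅x, y⁆ = t) (h1 : ⁅t, x⁆ = 0) (h2 : ⁅t, y⁆ = 0)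
    (hs : (ad k L t).IsSemisimple) : ad k L t = 0 := by
  rw [hs.eq_zero_iff_forall_eigenvalue]
  intro μ hμ
  have stab : ∀ a, ⁅t, a⁆ = 0 → ∀ v ∈ (ad k L t).eigenspace μ,
      ad k L a v ∈ (ad k L t).eigenspace μ := by
    intro a ha v hv
    rw [Module.End.mem_eigenspace_iff] at hv ⊢
    simp only [ad_apply] at hv ⊢
    rw [leibniz_lie, ha, zero_lie, zero_add, hv, lie_smul]
  set X := (ad k L x).restrict (stab x h1)
  set Y := (ad k L y).restrict (stab y h2)
  have hXY : X * Y - Y * X = μ • LinearMap.id := by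
    ext ⟨v, hv⟩
    have hv' := Module.End.mem_eigenspace_iff.1 hv
    simp only [ad_apply] at hv'
    simp [X, Y, LinearMap.restrict_apply, ← hv', ← ht, lie_lie]
  have htr := congrArg (LinearMap.trace k _) hXY
  rw [map_sub, LinearMap.trace_mul_comm, sub_self, map_smul, LinearMap.trace_id, smul_eq_mul] at htr
  have hpos : (finrank k ((ad k L t).eigenspace μ) : k) ≠ 0 := by
    have : Nontrivial ((ad k L t).eigenspace μ) := Submodule.nontrivial_iff_ne_bot.2 hμ
    exact_mod_cast finrank_pos.ne'
  exact (mul_eq_zero.1 htr.symm).resolve_right hpos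

lemma abstract_dim_one {n : ℕ} (σ : Fin n → (L ≃ₗ[k] L))
    (hss : ∀ i, Module.End.IsSemisimple (σ i : L →ₗ[k] L))
    (hlie : ∀ i (x y : L), σ i ⁅x, y⁆ = ⁅σ i x, σ i y⁆)
    (hcomm : ∀ i j (x : L), σ i (σ j x) = σ j (σ i x))
    (H : LieSubalgebra k L) (hab : ∀ a ∈ H, ∀ b ∈ H, ⁅a, b⁆ = 0)
    (hfix : ∀ a ∈ H, ∀ i, σ i a = a)
    (hcent : ∀ z, (∀ i, σ i z = z) → (∀ a ∈ H, ⁅a, z⁆ = 0) → z ∈ H)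
    (hnd : ∀ z ∈ H, (∀ a ∈ H, killingForm k L z a = 0) → z = 0)
    (α : Module.Dual k H) (hα0 : α ≠ 0)
    (c : Fin n → k) (x : L) (hx0 : x ≠ 0) (hx : ∀ a : H, ⁅(a : L), x⁆ = α a • x)
    (hxe : ∀ i, σ i x = c i • x) (w : L) (hw : ∀ a : H, ⁅(a : L), w⁆ = α a • w)
    (hwe : ∀ i, σ i w = c i • w) : ∃ d : k, w = d • x := by
  have hsemi : ∀ a ∈ H, (ad k L a).IsSemisimple := fun a ha =>
    semisimple_of_mem σ hlie H hab hfix hcent hnd ha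
  -- the opposite root vector
  obtain ⟨y, χ, hχ, hxy⟩ := exists_joint_eigenvector (k := k) (V := L) (ι := Fin n ⊕ H)
    (Sum.elim (fun i => (σ i : L →ₗ[k] L)) (fun a => ad k L (a : L)))
    (by
      rintro (i | a) (j | b)
      · ext z; simp [hcomm i j]
      · ext z; simp [hlie, hfix _ b.2]
      · ext z; simp [hlie, hfix _ a.2]
      · ext z
        have h2 := lie_lie (a : L) (b : L) z
        rw [hab _ a.2 _ b.2, zero_lie] at h2
        simpa using (sub_eq_zero.1 h2.symm))
    (by
      rintro (i | a)
      · exact hss i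
      · exact hsemi _ a.2)
    (killingForm k L x)
    (by
      intro h
      have : x ∈ LinearMap.ker (killingForm k L) := h
      rw [IsKilling.ker_killingForm_eq_bot] at this
      exact hx0 this)
  have hye : ∀ i, σ i y = χ (Sum.inl i) • y := fun i => hχ (Sum.inl i)
  have hcχ : ∀ i, c i * χ (Sum.inl i) = 1 := by
    intro i
    have := killing_inv (σ i) (hlie i) x y
    rw [hxe, hye] at this
    simp only [map_smul, LinearMap.smul_apply, smul_eq_mul] at this
    rw [← mul_assoc, mul_comm (χ _)] at this
    exact mul_right_cancel₀ hxy (by rw [this, one_mul])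
  have hya : ∀ a : H, ⁅(a : L), y⁆ = -(α a • y) := by
    intro a
    have h1 : ⁅(a : L), y⁆ = χ (Sum.inr a) • y := hχ (Sum.inr a)
    have h2 := traceForm_apply_lie_apply' k L L (a : L) x y
    rw [hx, h1] at h2
    simp only [map_smul, LinearMap.smul_apply, smul_eq_mul] at h2
    have h3 : (α a + χ (Sum.inr a)) * killingForm k L x y = 0 := by
      rw [add_mul]; exact add_eq_zero_iff_eq_neg.2 h2
    rw [h1, ← neg_smul]
    congr 1
    exact (neg_eq_of_add_eq_zero_right ((mul_eq_zero.1 h3).resolve_right hxy)).symm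
  -- brackets of root vectors with `y` lie in `H`
  have hbr : ∀ u : L, (∀ a : H, ⁅(a : L), u⁆ = α a • u) → (∀ i, σ i u = c i • u) →
      ⁅u, y⁆ ∈ H ∧ ∀ a : H, killingForm k L ⁅u, y⁆ a = α a * killingForm k L u y := by
    intro u hu hue
    refine ⟨hcent _ (fun i => ?_) (fun a ha => ?_), fun a => ?_⟩
    · rw [hlie, hue, hye, smul_lie, lie_smul, smul_smul, hcχ, one_smul]
    · rw [leibniz_lie, hu ⟨a, ha⟩, hya ⟨a, ha⟩]; simp
    · have h1 := traceForm_apply_lie_apply k L L (a : L) u y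
      rw [hu] at h1
      have h2 := traceForm_comm k L L ⁅u, y⁆ (a : L)
      change traceForm k L L _ _ = _
      rw [h2, ← h1]
      simp
  obtain ⟨htH, htK⟩ := hbr x hx hxe
  set t := ⁅x, y⁆ with ht
  obtain ⟨a₀, ha₀⟩ : ∃ a, α a ≠ 0 := by
    by_contra! h
    exact hα0 (LinearMap.ext h)
  have ht0 : t ≠ 0 := by
    intro h0
    have := htK a₀
    rw [h0, map_zero, LinearMap.zero_apply] at this
    exact mul_ne_zero ha₀ hxy this.symm
  set p := α ⟨t, htH⟩ with hp
  have htx : ⁅t, x⁆ = p • x := hx ⟨t, htH⟩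
  have hty : ⁅t, y⁆ = -(p • y) := hya ⟨t, htH⟩
  have hp0 : p ≠ 0 := by
    intro h0
    apply ht0
    have h1 := ad_eq_zero_of_comm (k := k) ht.symm (by rw [htx, h0, zero_smul])
      (by rw [hty, h0, zero_smul, neg_zero]) (hsemi t htH)
    refine hnd t htH fun a _ => ?_
    rw [killingForm_apply_apply, h1]; simp
  -- correct `w`
  refine ⟨killingForm k L w y / killingForm k L x y, ?_⟩
  set d := killingForm k L w y / killingForm k L x y with hd
  rw [← sub_eq_zero]
  by_contra hv0
  set v := w - d • x with hv
  have hva : ∀ a : H, ⁅(a : L), v⁆ = α a • v := by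
    intro a
    rw [hv, lie_sub, lie_smul, hx, hw, smul_sub, smul_comm]
  have hve : ∀ i, σ i v = c i • v := by
    intro i
    rw [hv, map_sub, map_smul, hxe, hwe, smul_sub, smul_comm]
  have hvy : killingForm k L v y = 0 := by
    rw [hv, map_sub, map_smul, LinearMap.sub_apply, LinearMap.smul_apply, smul_eq_mul, hd,
      div_mul_cancel₀ _ hxy, sub_self]
  obtain ⟨hvH, hvK⟩ := hbr v hva hve
  have hvy0 : ⁅v, y⁆ = 0 := hnd _ hvH fun a ha => by rw [hvK ⟨a, ha⟩, hvy, mul_zero]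
  have q : (2 / p) * p = 2 := div_mul_cancel₀ _ hp0
  have tri : IsSl2Triple ((2 / p) • t) x ((2 / p) • y) :=
    { h_ne_zero := smul_ne_zero (div_ne_zero two_ne_zero hp0) ht0
      lie_e_f := by rw [lie_smul]
      lie_h_e_nsmul := by
        rw [smul_lie, htx, smul_smul, q, two_smul, two_smul]
      lie_h_f_nsmul := by
        rw [smul_lie, lie_smul, hty, smul_neg, smul_neg, smul_comm (2 / p) p, smul_smul (2 / p) p,
          q, two_smul, two_smul] }
  have prim : tri.symm.HasPrimitiveVectorWith v (-2 : k) :=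
    { ne_zero := hv0
      lie_h := by
        rw [neg_lie, smul_lie, hva ⟨t, htH⟩, smul_smul, ← hp, q, neg_smul]
      lie_e := by rw [smul_lie, ← lie_skew, hvy0]; simp }
  obtain ⟨N, hN⟩ := prim.exists_nat
  have : ((N + 2 : ℕ) : k) = 0 := by push_cast; rw [← hN]; ring
  exact absurd this (by exact_mod_cast (by omega : N + 2 ≠ 0))

end

/-- The trace form on a Cartan subalgebra of the fixed points is nondegenerate. -/
lemma cartan_fixed_nondeg {k L : Type*} [Field k] [IsAlgClosed k] [CharZero k]
    [LieRing L] [LieAlgebra k L] [FiniteDimensional k L] [IsKilling k L]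
    {n : ℕ} (σ : Fin n → (L ≃ₗ[k] L))
    (hss : ∀ i, Module.End.IsSemisimple (σ i : L →ₗ[k] L))
    (hlie : ∀ i (x y : L), σ i ⁅x, y⁆ = ⁅σ i x, σ i y⁆)
    (hcomm : ∀ i j (x : L), σ i (σ j x) = σ j (σ i x))
    (G : LieSubalgebra k L) (hGmem : ∀ v, v ∈ G ↔ ∀ i, σ i v = v)
    (h : LieSubalgebra k G) (hcart : h.IsCartanSubalgebra) :
    LinearMap.ker (traceForm k h L) = ⊥ := by
  have : h.IsCartanSubalgebra := hcart
  have hnilp : LieRing.IsNilpotent h := hcart.nilpotent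
  rw [LinearMap.ker_eq_bot']
  intro z hz
  -- orthogonal to the fixed points
  have hG : ∀ g : G, traceForm k G L (z : G) g = 0 := by
    intro g
    have hcd : (g : G) ∈ (rootSpace h (0 : h → k)) ⊔ posFittingComp k h G := by
      rw [(isCompl_genWeightSpace_zero_posFittingComp k h G).sup_eq_top]
      exact LieSubmodule.mem_top _
    obtain ⟨a, ha, b, hb, rfl⟩ := (LieSubmodule.mem_sup _ _ _).1 hcd
    rw [map_add]
    have h1 : traceForm k G L (z : G) b = 0 := by
      refine eq_zero_of_mem_genWeightSpace_mem_posFitting (R := k) (L := h) (M := G)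
        (B := traceForm k G L) (fun u m m' => ?_) (m₀ := (z : G)) (m₁ := b) ?_ hb
      · exact traceForm_apply_lie_apply' k G L (u : G) m m'
      · exact le_zeroRootSubalgebra k G h z.2
    rw [rootSpace_zero_eq, LieSubalgebra.mem_toLieSubmodule] at ha
    have h2 : traceForm k G L (z : G) a = 0 := LinearMap.congr_fun hz ⟨a, ha⟩
    rw [h1, h2, add_zero]
  by_contra hz0
  obtain ⟨v, χ, hχ, hne⟩ := exists_joint_eigenvector (k := k) (V := L)
    (fun i => (σ i : L →ₗ[k] L)) (fun i j => by ext w; simp [hcomm i j]) hss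
    (killingForm k L ((z : G) : L)) (by
      intro h0
      have : ((z : G) : L) ∈ LinearMap.ker (killingForm k L) := h0
      rw [IsKilling.ker_killingForm_eq_bot] at this
      exact hz0 (Subtype.ext (Subtype.ext this)))
  have hv : ∀ i, σ i v = v := by
    intro i
    have h1 : σ i v = χ i • v := hχ i
    have h2 := killing_inv (σ i) (hlie i) ((z : G) : L) v
    rw [(hGmem _).1 (z : G).2 i, h1, map_smul, smul_eq_mul] at h2
    rw [h1, mul_right_cancel₀ hne (h2.trans (one_mul _).symm), one_smul]
  exact hne (hG ⟨v, (hGmem v).2 hv⟩)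


/-- in the `Q_h × Λ̄` grading of `g`, if `g_α^λ̄ ≠ 0` for a nonzero root `α`,
then `dim g_α^λ̄ = 1`: any nonzero `x ∈ g_α^λ̄` spans it. -/
theorem root_space_dim_one
    (k L : Type*) [Field k] [IsAlgClosed k] [CharZero k]
    [LieRing L] [LieAlgebra k L] [FiniteDimensional k L] [LieAlgebra.IsSimple k L]
    {n : ℕ} (σ : Fin n → (L ≃ₗ[k] L)) (m : Fin n → ℕ) (hm : ∀ i, 0 < m i)
    (ζ : Fin n → k) (hζ : ∀ i, IsPrimitiveRoot (ζ i) (m i))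
    (hlie : ∀ i (x y : L), σ i ⁅x, y⁆ = ⁅σ i x, σ i y⁆)
    (hcomm : ∀ i j (x : L), σ i (σ j x) = σ j (σ i x))
    (horder : ∀ i, σ i ^ (m i) = 1)
    (hne : fixedLieSubalgebra σ hlie ≠ ⊥)
    (h : LieSubalgebra k ↥(fixedLieSubalgebra σ hlie))
    (hcartan : h.IsCartanSubalgebra)
    (α : Module.Dual k ↥(h.map (fixedLieSubalgebra σ hlie).incl)) (hα0 : α ≠ 0)
    (l : Fin n → ℤ) (x : L) (hx0 : x ≠ 0)
    (hxroot : x ∈ rootSpaceOf (h.map (fixedLieSubalgebra σ hlie).incl) α)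
    (hxeig : ∀ i, σ i x = ζ i ^ (l i) • x) :
    ∀ y : L, y ∈ rootSpaceOf (h.map (fixedLieSubalgebra σ hlie).incl) α →
      (∀ i, σ i y = ζ i ^ (l i) • y) → ∃ c : k, y = c • x := by
  have hss : ∀ i, Module.End.IsSemisimple (σ i : L →ₗ[k] L) := fun i =>
    finite_order_semisimple (σ i) (m i) (hm i) (horder i)
  have : IsKilling k L := inferInstance
  have hker := cartan_fixed_nondeg σ hss hlie hcomm (fixedLieSubalgebra σ hlie)
    (fun _ => Iff.rfl) h hcartan
  have habel : IsLieAbelian h := isLieAbelian_of_ker_traceForm_eq_bot k h L hker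
  intro y hy hye
  refine abstract_dim_one σ hss hlie hcomm (h.map (fixedLieSubalgebra σ hlie).incl)
    ?_ ?_ ?_ ?_ α hα0 (fun i => ζ i ^ (l i)) x hx0 hxroot hxeig y hy hye
  · rintro _ ⟨a, ha, rfl⟩ _ ⟨b, hb, rfl⟩
    have h1 : ⁅(⟨a, ha⟩ : h), (⟨b, hb⟩ : h)⁆ = 0 := trivial_lie_zero _ _ _ _
    have h2 : ⁅a, b⁆ = 0 := congrArg Subtype.val h1
    exact congrArg Subtype.val h2
  · rintro _ ⟨a, ha, rfl⟩ i
    exact a.2 i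
  · intro z hz hza
    refine ⟨⟨z, hz⟩, ?_, rfl⟩
    have hmem : (⟨z, hz⟩ : fixedLieSubalgebra σ hlie) ∈ h.normalizer := by
      rw [LieSubalgebra.mem_normalizer_iff]
      intro a ha
      have h0 : ⁅(⟨z, hz⟩ : fixedLieSubalgebra σ hlie), a⁆ = 0 := by
        rw [← lie_skew, neg_eq_zero]
        exact Subtype.ext (hza a ⟨a, ha, rfl⟩)
      rw [h0]
      exact h.zero_mem
    rwa [LieSubalgebra.IsCartanSubalgebra.self_normalizing] at hmem
  · rintro _ ⟨a, ha, rfl⟩ hK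
    have h1 : (⟨a, ha⟩ : h) ∈ LinearMap.ker (traceForm k h L) := by
      rw [LinearMap.mem_ker]
      ext b
      exact hK _ ⟨b, b.2, rfl⟩
    rw [hker, Submodule.mem_bot] at h1
    have h2 : a = 0 := congrArg Subtype.val h1
    rw [h2]
    rfl
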